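/- Let Λ ⊆ ℂ be a lattice. Then for every z ∈ ℂ∖Λ, the family ( (z−ω)⁻² − ω⁻² )_{ω ∈ Λ∖{0}} is absolutely summable; in particular the series defining the Weierstrass ℘-function ℘_Λ(z) = z⁻² + ∑_{ω ∈ Λ∖{0}} ( (z−ω)⁻² − ω⁻² ) converges for every z ∈ ℂ∖Λ. -/

import Mathlib

open Filter

/-- A lattice in `ℂ`: a discrete additive subgroup that spans `ℂ` as a real vector
space. -/
def IsComplexLattice (Λ : AddSubgroup ℂ) : Prop :=
  DiscreteTopology Λ ∧ Submodule.span ℝ (Λ : Set ℂ) = ⊤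

/-- The nonzero elements of a lattice `Λ ⊆ ℂ`. -/
def latticeNonzero (Λ : AddSubgroup ℂ) : Type := {ω : ℂ // ω ∈ Λ ∧ ω ≠ 0}

/-- The Weierstrass ℘-function of a lattice `Λ ⊆ ℂ`:
`℘_Λ(z) = z⁻² + ∑_{ω ∈ Λ∖{0}} ((z−ω)⁻² − ω⁻²)` (junk value on `Λ`). -/
noncomputable def wp (Λ : AddSubgroup ℂ) (z : ℂ) : ℂ :=
  (z ^ 2)⁻¹ + ∑' ω : latticeNonzero Λ, (((z - ω.1) ^ 2)⁻¹ - (ω.1 ^ 2)⁻¹)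

/-- For a lattice `Λ ⊆ ℂ` and `z ∈ ℂ∖Λ`, the family `((z−ω)⁻² − ω⁻²)_{ω ∈ Λ∖{0}}` is
absolutely summable; in particular the series defining `℘_Λ(z)` converges. -/
theorem wp_summand_absolutely_summable (Λ : AddSubgroup ℂ) (hΛ : IsComplexLattice Λ)
    (z : ℂ) (hz : z ∉ Λ) :
    Summable (fun ω : latticeNonzero Λ => ‖((z - ω.1) ^ 2)⁻¹ - (ω.1 ^ 2)⁻¹‖) ∧
    Summable (fun ω : latticeNonzero Λ => ((z - ω.1) ^ 2)⁻¹ - (ω.1 ^ 2)⁻¹) := by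
  suffices h : Summable (fun ω : latticeNonzero Λ => ‖((z - ω.1) ^ 2)⁻¹ - (ω.1 ^ 2)⁻¹‖) from
    ⟨h, h.of_norm⟩
  obtain ⟨hd, hs⟩ := hΛ
  let L : Submodule ℤ ℂ := AddSubgroup.toIntSubmodule Λ
  haveI : DiscreteTopology L := hd
  haveI : IsZLattice ℝ L := ⟨hs⟩
  have hr : Module.finrank ℤ L = 2 := by
    rw [ZLattice.rank ℝ L, Complex.finrank_real_complex]
  have h3 := ZLattice.summable_norm_pow_inv L 3 (by omega)
  have hinj : Function.Injective (fun ω : latticeNonzero Λ => (⟨ω.1, ω.2.1⟩ : L)) := by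
    intro a b hab
    exact Subtype.ext (congrArg (fun x : L => (x : ℂ)) hab)
  have h4 : Summable (fun ω : latticeNonzero Λ => (‖ω.1‖ ^ 3)⁻¹) := by
    simpa [Function.comp_def] using h3.comp_injective hinj
  set r : ℝ := ‖z‖ + 1 with hrdef
  have hr0 : 0 < r := by positivity
  refine Summable.of_norm_bounded_eventually (h4.mul_left (10 * r)) ?_
  have hc : ∀ᶠ ω : latticeNonzero Λ in cofinite, (‖ω.1‖ ^ 3)⁻¹ < ((2 * r) ^ 3)⁻¹ :=
    h4.tendsto_cofinite_zero.eventually_lt_const (by positivity)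
  filter_upwards [hc] with ω hω
  have hpos : 0 < ‖ω.1‖ := norm_pos_iff.mpr ω.2.2
  have h2 : 2 * r ≤ ‖ω.1‖ := by
    have := (inv_lt_inv₀ (by positivity) (by positivity)).mp hω
    exact (lt_of_pow_lt_pow_left₀ 3 hpos.le this).le
  have hb := PeriodPair.weierstrassP_bound r hr0 z (by simp [hrdef]) ω.1 h2
  have he : ‖ω.1‖ ^ (-3 : ℝ) = (‖ω.1‖ ^ 3)⁻¹ := by
    rw [Real.rpow_neg hpos.le]
    norm_cast
  rw [he, one_div, one_div] at hb
  rwa [norm_norm]
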